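/- Let P, Q ∈ ℂ[x,y] be polynomials of degree n ≥ 2 whose zero divisors intersect transversely at exactly n² distinct points p₁,…,p_{n²} ∈ ℂ², and let J(x,y) = ∂P/∂x·∂Q/∂y − ∂P/∂y·∂Q/∂x be the Jacobian determinant. Then for any polynomial g of degree at most 2n−3, the sum over k of g(p_k)/J(p_k) equals 0. -/

import Mathlib

open MvPolynomial

theorem ej_finrank (m : ℕ) :
    2 * Module.finrank ℂ (restrictTotalDegree (Fin 2) ℂ m) = (m + 1) * (m + 2) := by
  have h1 : Module.finrank ℂ (restrictTotalDegree (Fin 2) ℂ m) =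
      Nat.card {s : Fin 2 →₀ ℕ | (s.sum fun _ e => e) ≤ m} :=
    Module.finrank_eq_nat_card_basis (basisRestrictSupport ℂ _)
  have hs : ∀ s : Fin 2 →₀ ℕ, (s.sum fun _ e => e) = s 0 + s 1 := by
    intro s
    rw [Finsupp.sum_fintype _ _ (by simp)]
    simp
  let e : {s : Fin 2 →₀ ℕ | (s.sum fun _ e => e) ≤ m} ≃ (Σ i : Fin (m + 1), Fin (i.1 + 1)) :=
    { toFun := fun s => ⟨⟨s.1 0 + s.1 1, by have := s.2; simp only [Set.mem_ofPred_eq, hs] at this; omega⟩,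
        ⟨s.1 0, by simp⟩⟩
      invFun := fun x => ⟨Finsupp.equivFunOnFinite.symm ![x.2.1, x.1.1 - x.2.1], by
        have := x.1.2
        have := x.2.2
        simp only [Set.mem_ofPred_eq, hs]
        simp
        omega⟩
      left_inv := by
        intro s
        ext i
        fin_cases i <;> simp
      right_inv := by
        rintro ⟨⟨i, hi⟩, ⟨j, hj⟩⟩
        simp only at hj
        have : j + (i - j) = i := by omega
        simp [Sigma.ext_iff, this]
        rw [Fin.heq_ext_iff]
        simp [this] }
  rw [h1, Nat.card_congr e, Nat.card_eq_fintype_card, Fintype.card_sigma]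
  simp only [Fintype.card_fin]
  rw [Fin.sum_univ_eq_sum_range (fun i => i + 1)]
  clear h1 e
  induction m with
  | zero => simp
  | succ k ih => rw [Finset.sum_range_succ, mul_add, ih]; ring

theorem ej_pow_sum {m : ℕ} (a : Fin m → ℂ) (ha : Function.Injective a) (d : ℕ) (hd : d + 2 ≤ m) :
    ∑ i, (a i) ^ d * Lagrange.nodalWeight Finset.univ a i = 0 := by
  have h := Lagrange.coeff_eq_sum (s := Finset.univ) (v := a) ha.injOn (P := Polynomial.X ^ d)
    (by rw [Polynomial.degree_X_pow]; simp; omega)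
  rw [Polynomial.coeff_X_pow, if_neg (by simp; omega)] at h
  rw [h]
  apply Finset.sum_congr rfl
  intro i _
  simp [Lagrange.nodalWeight, div_eq_mul_inv]

theorem ej_grid {m : ℕ} (a b : Fin m → ℂ) (ha : Function.Injective a) (hb : Function.Injective b)
    (F : MvPolynomial (Fin 2) ℂ) (hF : F.totalDegree + 3 ≤ 2 * m) :
    ∑ i, ∑ j, eval ![a i, b j] F * Lagrange.nodalWeight Finset.univ a i *
      Lagrange.nodalWeight Finset.univ b j = 0 := by
  simp only [eval_eq', Finset.sum_mul]
  have : ∀ i, ∑ j, ∑ d ∈ F.support, coeff d F * (∏ k, (![a i, b j] k) ^ d k) *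
      Lagrange.nodalWeight Finset.univ a i * Lagrange.nodalWeight Finset.univ b j =
      ∑ d ∈ F.support, ∑ j, coeff d F * (∏ k, (![a i, b j] k) ^ d k) *
      Lagrange.nodalWeight Finset.univ a i * Lagrange.nodalWeight Finset.univ b j :=
    fun i => Finset.sum_comm
  have key : ∀ d ∈ F.support, ∑ i, ∑ j, coeff d F * (∏ k, (![a i, b j] k) ^ d k) *
      Lagrange.nodalWeight Finset.univ a i * Lagrange.nodalWeight Finset.univ b j = 0 := by
    intro d hd
    have h1 := le_totalDegree hd
    rw [Finsupp.sum_fintype _ _ (by simp)] at h1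
    simp only [Fin.sum_univ_two] at h1
    have : ∑ i, ∑ j, coeff d F * (∏ k, (![a i, b j] k) ^ d k) *
      Lagrange.nodalWeight Finset.univ a i * Lagrange.nodalWeight Finset.univ b j =
      coeff d F * ((∑ i, a i ^ d 0 * Lagrange.nodalWeight Finset.univ a i) *
        (∑ j, b j ^ d 1 * Lagrange.nodalWeight Finset.univ b j)) := by
      rw [Finset.sum_mul_sum, Finset.mul_sum]
      refine Finset.sum_congr rfl fun i _ => ?_
      rw [Finset.mul_sum]
      refine Finset.sum_congr rfl fun j _ => ?_
      simp [Fin.prod_univ_two]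
      ring
    rw [this]
    rcases (by omega : d 0 + 2 ≤ m ∨ d 1 + 2 ≤ m) with h | h
    · rw [ej_pow_sum a ha _ h]; simp
    · rw [ej_pow_sum b hb _ h]; simp
  simp_rw [this]
  rw [Finset.sum_comm]
  exact Finset.sum_eq_zero key

theorem ej_deg_bind (l : Fin 2 → MvPolynomial (Fin 2) ℂ) (hl : ∀ i, (l i).totalDegree ≤ 1)
    (F : MvPolynomial (Fin 2) ℂ) : (bind₁ l F).totalDegree ≤ F.totalDegree := by
  rw [bind₁, aeval_def, eval₂_eq]
  refine (totalDegree_finsetSum _ _).trans (Finset.sup_le fun d hd => ?_)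
  refine (totalDegree_mul _ _).trans ?_
  have h1 := le_totalDegree hd
  refine le_trans ?_ h1
  rw [algebraMap_eq, totalDegree_C, zero_add]
  refine (totalDegree_finsetProd _ _).trans (Finset.sum_le_sum fun i _ => ?_)
  refine (totalDegree_pow _ _).trans ?_
  have := hl i
  nlinarith

theorem ej_deg_aeval (l : MvPolynomial (Fin 2) ℂ) (hl : l.totalDegree ≤ 1)
    (f : Polynomial ℂ) : (Polynomial.aeval l f).totalDegree ≤ f.natDegree := by
  rw [Polynomial.aeval_eq_sum_range]
  refine (totalDegree_finsetSum _ _).trans (Finset.sup_le fun d hd => ?_)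
  refine (totalDegree_smul_le _ _).trans ((totalDegree_pow _ _).trans ?_)
  have := Finset.mem_range.1 hd
  nlinarith

theorem ej_zero (h : MvPolynomial (Fin 2) ℂ) (hu : ¬ IsUnit h) : ∃ x, eval x h = 0 := by
  obtain ⟨M, hM, hh⟩ := exists_max_ideal_of_mem_nonunits hu
  obtain ⟨x, hx⟩ := (isMaximal_iff_eq_vanishingIdeal_singleton).1 hM
  refine ⟨x, ?_⟩
  rw [hx, mem_vanishingIdeal_singleton_iff] at hh
  simpa [aeval_eq_eval] using hh

theorem ej_relprime (P Q : MvPolynomial (Fin 2) ℂ)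
    (h : ∀ x, eval x P = 0 → eval x Q = 0 →
      eval x (pderiv 0 P * pderiv 1 Q - pderiv 1 P * pderiv 0 Q) ≠ 0) : IsRelPrime P Q := by
  rintro d ⟨P, rfl⟩ ⟨Q, rfl⟩
  by_contra hu
  obtain ⟨x, hx⟩ := ej_zero d hu
  apply h x (by simp [hx]) (by simp [hx])
  simp [Derivation.leibniz, hx]
  ring

theorem ej_generic {m : ℕ} (p : Fin m → (Fin 2 → ℂ)) (hp : Function.Injective p) :
    ∃ s t : ℂ, s ≠ t ∧ (Function.Injective fun k => p k 0 + s * p k 1) ∧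
      (Function.Injective fun k => p k 0 + t * p k 1) := by
  let B : Set ℂ := Set.range fun x : Fin m × Fin m => -(p x.1 0 - p x.2 0) / (p x.1 1 - p x.2 1)
  have hB : B.Finite := Set.finite_range _
  have hgood : ∀ s ∉ B, Function.Injective fun k => p k 0 + s * p k 1 := by
    intro s hs k l hkl
    simp only at hkl
    by_cases h1 : p k 1 = p l 1
    · apply hp
      ext i
      fin_cases i
      · simpa [h1] using hkl
      · exact h1
    · exfalso
      apply hs
      refine ⟨(k, l), ?_⟩
      have : p k 1 - p l 1 ≠ 0 := sub_ne_zero.2 h1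
      field_simp
      linear_combination -hkl
  obtain ⟨s, hs⟩ := hB.infinite_compl.nonempty
  obtain ⟨t, ht⟩ := (hB.union (Set.finite_singleton s)).infinite_compl.nonempty
  simp only [Set.mem_compl_iff, Set.mem_union, Set.mem_singleton_iff, not_or] at ht
  exact ⟨s, t, fun h => ht.2 h.symm, hgood s hs, hgood t ht.1⟩

theorem ej_deg_lin (s : ℂ) : (X 0 + C s * X 1 : MvPolynomial (Fin 2) ℂ).totalDegree ≤ 1 := by
  refine (totalDegree_add _ _).trans (max_le (by simp) ((totalDegree_mul _ _).trans (by simp)))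

theorem ej_eval_aeval (s : ℂ) (L : Polynomial ℂ) (x : Fin 2 → ℂ) :
    eval x (Polynomial.aeval (X 0 + C s * X 1 : MvPolynomial (Fin 2) ℂ) L) =
      L.eval (x 0 + s * x 1) := by
  rw [← coe_aeval_eq_eval]
  change (aeval x) _ = _
  rw [← Polynomial.aeval_algHom_apply]
  simp [Polynomial.aeval_def, Polynomial.eval₂_eq_eval_map]

theorem ej_noether (n : ℕ) (hn : 2 ≤ n) (P Q : MvPolynomial (Fin 2) ℂ)
    (hP : P.totalDegree = n) (hQ : Q.totalDegree = n) (hrel : IsRelPrime P Q)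
    (p : Fin (n ^ 2) → (Fin 2 → ℂ)) (hPp : ∀ k, eval (p k) P = 0) (hQp : ∀ k, eval (p k) Q = 0)
    (s : ℂ) (hs : Function.Injective fun k => p k 0 + s * p k 1)
    (f : MvPolynomial (Fin 2) ℂ) (hf : f.totalDegree ≤ n ^ 2) (hfp : ∀ k, eval (p k) f = 0) :
    ∃ A B : MvPolynomial (Fin 2) ℂ, A.totalDegree ≤ n ^ 2 - n ∧ B.totalDegree ≤ n ^ 2 - n ∧
      f = A * P + B * Q := by
  have hn2 : 2 * n ≤ n ^ 2 := by nlinarith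
  have hP0 : P ≠ 0 := by rintro rfl; simp at hP; omega
  have hQ0 : Q ≠ 0 := by rintro rfl; simp at hQ; omega
  let V := restrictTotalDegree (Fin 2) ℂ (n ^ 2)
  let V1 := restrictTotalDegree (Fin 2) ℂ (n ^ 2 - n)
  let V2 := restrictTotalDegree (Fin 2) ℂ (n ^ 2 - 2 * n)
  let ev : V →ₗ[ℂ] (Fin (n ^ 2) → ℂ) :=
    LinearMap.pi fun k => (aeval (p k) : MvPolynomial (Fin 2) ℂ →ₐ[ℂ] ℂ).toLinearMap ∘ₗ V.subtype
  have hev : ∀ (v : V) k, ev v k = eval (p k) v.1 := by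
    intro v k
    simp [ev, aeval_eq_eval]
  have hsurj : Function.Surjective ev := by
    intro r
    have hinj : Set.InjOn (fun k => p k 0 + s * p k 1) (Finset.univ : Finset (Fin (n ^ 2))) :=
      hs.injOn
    let L := Lagrange.interpolate Finset.univ (fun k => p k 0 + s * p k 1) r
    have hL : L.natDegree ≤ n ^ 2 := by
      have := Lagrange.degree_interpolate_lt r hinj
      apply Polynomial.natDegree_le_of_degree_le
      exact this.le.trans (by simp)
    refine ⟨⟨Polynomial.aeval (X 0 + C s * X 1 : MvPolynomial (Fin 2) ℂ) L, ?_⟩, ?_⟩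
    · rw [mem_restrictTotalDegree]
      exact (ej_deg_aeval _ (ej_deg_lin s) _).trans hL
    · ext k
      rw [hev, ej_eval_aeval]
      exact Lagrange.eval_interpolate_at_node r hinj (Finset.mem_univ k)
  let φ : (V1 × V1) →ₗ[ℂ] MvPolynomial (Fin 2) ℂ :=
    LinearMap.coprod (LinearMap.mulRight ℂ P ∘ₗ V1.subtype) (LinearMap.mulRight ℂ Q ∘ₗ V1.subtype)
  have hφ : ∀ x : V1 × V1, φ x = x.1.1 * P + x.2.1 * Q := fun x => by simp [φ]
  let ψ : V2 →ₗ[ℂ] (MvPolynomial (Fin 2) ℂ × MvPolynomial (Fin 2) ℂ) :=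
    LinearMap.prod (LinearMap.mulRight ℂ Q ∘ₗ V2.subtype) (LinearMap.mulRight ℂ (-P) ∘ₗ V2.subtype)
  have hψ : ∀ x : V2, ψ x = (x.1 * Q, x.1 * (-P)) := fun x => by simp [ψ]
  let ι : (V1 × V1) →ₗ[ℂ] (MvPolynomial (Fin 2) ℂ × MvPolynomial (Fin 2) ℂ) :=
    LinearMap.prodMap V1.subtype V1.subtype
  have hι : Function.Injective ι := by
    rintro ⟨a, b⟩ ⟨c, d⟩ h
    simpa [ι] using h
  let I : Submodule ℂ (MvPolynomial (Fin 2) ℂ) := (LinearMap.ker ev).map V.subtype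
  have hI : ∀ g, g ∈ I ↔ g.totalDegree ≤ n ^ 2 ∧ ∀ k, eval (p k) g = 0 := by
    intro g
    simp only [I, Submodule.mem_map, LinearMap.mem_ker]
    constructor
    · rintro ⟨v, hv, rfl⟩
      refine ⟨(mem_restrictTotalDegree _ _ _).1 v.2, fun k => ?_⟩
      have := congrFun hv k
      rwa [hev] at this
    · rintro ⟨h1, h2⟩
      refine ⟨⟨g, (mem_restrictTotalDegree _ _ _).2 h1⟩, ?_, rfl⟩
      ext k
      rw [hev]
      exact h2 k
  have hfinI : Module.finrank ℂ I = Module.finrank ℂ (LinearMap.ker ev) :=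
    (LinearEquiv.finrank_eq (Submodule.equivMapOfInjective V.subtype V.injective_subtype _)).symm
  have hrange : LinearMap.range φ ≤ I := by
    rintro _ ⟨⟨a, b⟩, rfl⟩
    rw [hI, hφ]
    have ha := (mem_restrictTotalDegree _ _ _).1 a.2
    have hb := (mem_restrictTotalDegree _ _ _).1 b.2
    refine ⟨(totalDegree_add _ _).trans (max_le ?_ ?_), fun k => by simp [hPp, hQp]⟩
    · refine (totalDegree_mul _ _).trans ?_
      simp only
      omega
    · refine (totalDegree_mul _ _).trans ?_
      simp only
      omega
  have hker : (LinearMap.ker φ).map ι ≤ LinearMap.range ψ := by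
    rintro _ ⟨⟨a, b⟩, hab, rfl⟩
    have hab' : φ (a, b) = 0 := hab
    rw [hφ] at hab'
    simp only at hab'
    have hdvd : Q ∣ a.1 * P := ⟨-b.1, by linear_combination hab'⟩
    obtain ⟨c, hc⟩ := hrel.symm.dvd_of_dvd_mul_right hdvd
    have hb : b.1 = c * (-P) := by
      apply mul_right_cancel₀ hQ0
      rw [hc] at hab'
      linear_combination hab'
    have hcV : c.totalDegree ≤ n ^ 2 - 2 * n := by
      by_cases hc0 : c = 0
      · simp [hc0]
      have ha := (mem_restrictTotalDegree _ _ _).1 a.2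
      rw [hc, totalDegree_mul_of_isDomain hQ0 hc0] at ha
      omega
    refine ⟨⟨c, (mem_restrictTotalDegree _ _ _).2 hcV⟩, ?_⟩
    rw [hψ]
    simp [ι, hc, hb, mul_comm]
  have e1 := ej_finrank (n ^ 2)
  have e2 := ej_finrank (n ^ 2 - n)
  have e3 := ej_finrank (n ^ 2 - 2 * n)
  have d1 := LinearMap.finrank_range_add_finrank_ker ev
  have d2 := LinearMap.finrank_range_add_finrank_ker φ
  have d3 : Module.finrank ℂ (LinearMap.ker φ) ≤ Module.finrank ℂ V2 := by
    rw [LinearEquiv.finrank_eq (Submodule.equivMapOfInjective ι hι (LinearMap.ker φ))]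
    exact (Submodule.finrank_mono hker).trans (LinearMap.finrank_range_le ψ)
  rw [LinearMap.range_eq_top.2 hsurj, finrank_top, Module.finrank_fin_fun] at d1
  rw [Module.finrank_prod] at d2
  have hEq : LinearMap.range φ = I := by
    apply Submodule.eq_of_le_of_finrank_le hrange
    rw [hfinI]
    obtain ⟨c, hc⟩ := Nat.exists_eq_add_of_le hn2
    have c1 : n ^ 2 - n = n + c := by omega
    have c2 : n ^ 2 - 2 * n = c := by omega
    change 2 * Module.finrank ℂ V = _ at e1
    change 2 * Module.finrank ℂ V1 = _ at e2
    change 2 * Module.finrank ℂ V2 = _ at e3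
    rw [c1] at e2
    rw [c2] at e3
    nlinarith
  have : f ∈ LinearMap.range φ := by
    rw [hEq, hI]
    exact ⟨hf, hfp⟩
  obtain ⟨⟨a, b⟩, hab⟩ := this
  exact ⟨a.1, b.1, (mem_restrictTotalDegree _ _ _).1 a.2, (mem_restrictTotalDegree _ _ _).1 b.2,
    by rw [← hab, hφ]⟩

theorem ej_pderiv (s : ℂ) (N : Polynomial ℂ) (x : Fin 2 → ℂ) :
    eval x (pderiv 0 (Polynomial.aeval (X 0 + C s * X 1 : MvPolynomial (Fin 2) ℂ) N)) =
      N.derivative.eval (x 0 + s * x 1) ∧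
    eval x (pderiv 1 (Polynomial.aeval (X 0 + C s * X 1 : MvPolynomial (Fin 2) ℂ) N)) =
      s * N.derivative.eval (x 0 + s * x 1) := by
  rw [Derivation.map_aeval, Derivation.map_aeval, smul_eq_mul, smul_eq_mul, map_mul, map_mul,
    ej_eval_aeval]
  constructor
  · simp [pderiv_X]
  · simp [pderiv_X, mul_comm]

/-- The Euler–Jacobi formula in two variables. -/
theorem euler_jacobi
    (n : ℕ) (hn : 2 ≤ n)
    (P Q : MvPolynomial (Fin 2) ℂ)
    (hP : P.totalDegree = n) (hQ : Q.totalDegree = n)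
    (J : MvPolynomial (Fin 2) ℂ)
    (hJ : J = pderiv 0 P * pderiv 1 Q - pderiv 1 P * pderiv 0 Q)
    (p : Fin (n ^ 2) → (Fin 2 → ℂ))
    (hinj : Function.Injective p)
    (hzeros : ∀ x : Fin 2 → ℂ, (eval x P = 0 ∧ eval x Q = 0) ↔ ∃ k, x = p k)
    (htrans : ∀ k, eval (p k) J ≠ 0)
    (g : MvPolynomial (Fin 2) ℂ) (hg : g.totalDegree ≤ 2 * n - 3) :
    ∑ k, eval (p k) g / eval (p k) J = 0 := by
  have hn2 : 2 * n ≤ n ^ 2 := by nlinarith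
  have hPp : ∀ k, eval (p k) P = 0 := fun k => ((hzeros _).2 ⟨k, rfl⟩).1
  have hQp : ∀ k, eval (p k) Q = 0 := fun k => ((hzeros _).2 ⟨k, rfl⟩).2
  have hrel : IsRelPrime P Q := by
    apply ej_relprime
    intro x hx hy
    obtain ⟨k, rfl⟩ := (hzeros x).1 ⟨hx, hy⟩
    rw [← hJ]
    exact htrans k
  obtain ⟨s, t, hst, ha, hb⟩ := ej_generic p hinj
  have hts : t - s ≠ 0 := sub_ne_zero.2 hst.symm
  have noether : ∀ r : ℂ, ∃ A B : MvPolynomial (Fin 2) ℂ, A.totalDegree ≤ n ^ 2 - n ∧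
      B.totalDegree ≤ n ^ 2 - n ∧ Polynomial.aeval (X 0 + C r * X 1 : MvPolynomial (Fin 2) ℂ)
        (Lagrange.nodal Finset.univ fun k => p k 0 + r * p k 1) = A * P + B * Q := by
    intro r
    refine ej_noether n hn P Q hP hQ hrel p hPp hQp s ha _ ?_ ?_
    · refine (ej_deg_aeval _ (ej_deg_lin r) _).trans ?_
      simp [Lagrange.natDegree_nodal]
    · intro k
      rw [ej_eval_aeval]
      exact Lagrange.eval_nodal_at_node (v := fun k => p k 0 + r * p k 1) (Finset.mem_univ k)
  obtain ⟨A, B, hA, hB, hAB⟩ := noether s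
  obtain ⟨E, D, hE, hD, hED⟩ := noether t
  set a : Fin (n ^ 2) → ℂ := fun k => p k 0 + s * p k 1 with ha_def
  set b : Fin (n ^ 2) → ℂ := fun k => p k 0 + t * p k 1 with hb_def
  let l : Fin 2 → MvPolynomial (Fin 2) ℂ :=
    ![C (t / (t - s)) * X 0 + C (-s / (t - s)) * X 1,
      C (-1 / (t - s)) * X 0 + C (1 / (t - s)) * X 1]
  have hlin : ∀ c d : ℂ, (C c * X 0 + C d * X 1 : MvPolynomial (Fin 2) ℂ).totalDegree ≤ 1 := by
    intro c d
    exact (totalDegree_add _ _).trans (max_le ((totalDegree_mul _ _).trans (by simp))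
      ((totalDegree_mul _ _).trans (by simp)))
  have hl : ∀ i, (l i).totalDegree ≤ 1 := by
    intro i
    fin_cases i
    · exact hlin _ _
    · exact hlin _ _
  let q : Fin (n ^ 2) → Fin (n ^ 2) → (Fin 2 → ℂ) := fun i j =>
    ![(t * a i - s * b j) / (t - s), (b j - a i) / (t - s)]
  have hq : ∀ i j G, eval ![a i, b j] (bind₁ l G) = eval (q i j) G := by
    intro i j G
    have : (fun k => eval ![a i, b j] (l k)) = q i j := by
      ext k
      fin_cases k
      · simp [l, q]; ring
      · simp [l, q]; ring
    rw [← this, ← coe_aeval_eq_eval, ← coe_aeval_eq_eval]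
    change aeval _ (bind₁ l G) = aeval _ G
    rw [aeval_bind₁]
    rfl
  have hqs : ∀ i j, q i j 0 + s * q i j 1 = a i := by
    intro i j
    simp only [q, Matrix.cons_val_zero, Matrix.cons_val_one]
    field_simp
    ring
  have hqt : ∀ i j, q i j 0 + t * q i j 1 = b j := by
    intro i j
    simp only [q, Matrix.cons_val_zero, Matrix.cons_val_one]
    field_simp
    ring
  have hqd : ∀ i, q i i = p i := by
    intro i
    ext k
    fin_cases k
    · simp only [q, a, b]
      simp
      field_simp
      ring
    · simp only [q, a, b]
      simp
      field_simp
  have hdeg : (g * (A * D - B * E)).totalDegree + 3 ≤ 2 * n ^ 2 := by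
    have h1 : (A * D - B * E).totalDegree ≤ 2 * (n ^ 2 - n) := by
      refine (totalDegree_sub _ _).trans (max_le ?_ ?_)
      · exact (totalDegree_mul _ _).trans (by omega)
      · exact (totalDegree_mul _ _).trans (by omega)
    have h2 := totalDegree_mul g (A * D - B * E)
    omega
  have hgrid := ej_grid a b ha hb (bind₁ l (g * (A * D - B * E)))
    (le_trans (Nat.add_le_add_right (ej_deg_bind l hl _) 3) hdeg)
  simp only [hq] at hgrid
  have hoff : ∀ i j, i ≠ j → eval (q i j) (A * D - B * E) = 0 := by
    intro i j hij
    by_contra hne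
    have e1 : eval (q i j) (A * P + B * Q) = 0 := by
      rw [← hAB, ej_eval_aeval, hqs]
      exact Lagrange.eval_nodal_at_node (Finset.mem_univ i)
    have e2 : eval (q i j) (E * P + D * Q) = 0 := by
      rw [← hED, ej_eval_aeval, hqt]
      exact Lagrange.eval_nodal_at_node (Finset.mem_univ j)
    simp only [map_add, map_mul, map_sub] at e1 e2 hne
    have z1 : eval (q i j) P = 0 := by
      apply (mul_eq_zero.1 _).resolve_left hne
      linear_combination (eval (q i j) D) * e1 - (eval (q i j) B) * e2
    have z2 : eval (q i j) Q = 0 := by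
      apply (mul_eq_zero.1 _).resolve_left hne
      linear_combination (eval (q i j) A) * e2 - (eval (q i j) E) * e1
    obtain ⟨k, hk⟩ := (hzeros _).1 ⟨z1, z2⟩
    have k1 := hqs i j
    have k2 := hqt i j
    rw [hk] at k1 k2
    exact hij ((ha k1).symm.trans (hb k2))
  have hdiag : ∀ i, eval (q i i) (g * (A * D - B * E)) * Lagrange.nodalWeight Finset.univ a i *
      Lagrange.nodalWeight Finset.univ b i = (t - s) * (eval (p i) g / eval (p i) J) := by
    intro i
    have w1 := Lagrange.nodalWeight_ne_zero ha.injOn (Finset.mem_univ i)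
    have w2 := Lagrange.nodalWeight_ne_zero hb.injOn (Finset.mem_univ i)
    rw [Lagrange.nodalWeight_eq_eval_derivative_nodal (Finset.mem_univ i)] at w1 w2 ⊢
    rw [Lagrange.nodalWeight_eq_eval_derivative_nodal (Finset.mem_univ i)]
    have w1' := inv_ne_zero w1
    have w2' := inv_ne_zero w2
    rw [inv_inv] at w1' w2'
    obtain ⟨d1, d2⟩ := ej_pderiv s (Lagrange.nodal Finset.univ a) (p i)
    obtain ⟨d3, d4⟩ := ej_pderiv t (Lagrange.nodal Finset.univ b) (p i)
    rw [hAB] at d1 d2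
    rw [hED] at d3 d4
    change _ = Polynomial.eval (a i) _ at d1
    change _ = s * Polynomial.eval (a i) _ at d2
    change _ = Polynomial.eval (b i) _ at d3
    change _ = t * Polynomial.eval (b i) _ at d4
    simp only [map_add, Derivation.leibniz, smul_eq_mul, map_mul, hPp, hQp, zero_mul, add_zero]
      at d1 d2 d3 d4
    have hJi := htrans i
    rw [hqd]
    have hJe : eval (p i) J = eval (p i) (pderiv 0 P) * eval (p i) (pderiv 1 Q) -
        eval (p i) (pderiv 1 P) * eval (p i) (pderiv 0 Q) := by rw [hJ]; simp
    have key : (t - s) * (Polynomial.eval (a i) (Lagrange.nodal Finset.univ a).derivative *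
        Polynomial.eval (b i) (Lagrange.nodal Finset.univ b).derivative) =
        eval (p i) (A * D - B * E) * eval (p i) J := by
      rw [hJe]
      simp only [map_sub, map_mul]
      have : (t - s) * (Polynomial.eval (a i) (Lagrange.nodal Finset.univ a).derivative *
        Polynomial.eval (b i) (Lagrange.nodal Finset.univ b).derivative) =
        Polynomial.eval (a i) (Lagrange.nodal Finset.univ a).derivative *
        (t * Polynomial.eval (b i) (Lagrange.nodal Finset.univ b).derivative) -
        (s * Polynomial.eval (a i) (Lagrange.nodal Finset.univ a).derivative) *
        Polynomial.eval (b i) (Lagrange.nodal Finset.univ b).derivative := by ring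
      rw [this, ← d4, ← d2, ← d1, ← d3]
      ring
    rw [map_mul]
    field_simp
    linear_combination (-eval (p i) g) * key
  have hsum : ∑ i, ∑ j, eval (q i j) (g * (A * D - B * E)) *
      Lagrange.nodalWeight Finset.univ a i * Lagrange.nodalWeight Finset.univ b j =
      (t - s) * ∑ k, eval (p k) g / eval (p k) J := by
    rw [Finset.mul_sum]
    refine Finset.sum_congr rfl fun i _ => ?_
    rw [Finset.sum_eq_single i, hdiag]
    · intro j _ hj
      rw [map_mul, hoff i j hj.symm]
      simp
    · simp
  rw [hsum] at hgrid
  exact (mul_eq_zero.1 hgrid).resolve_left hts
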